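/- arXiv:2511.00811 — 7 statements merged into one kernel-verified Lean document; each statement's English description precedes it below -/
import Mathlib

section
/- Define an increasing family of sets of states by T_0 = {s | f(s)} and T_{k+1} = T_k ∪ {s | ¬f(s) and there exists a pursuer move n_p at s such that (n_p, n_e) ∈ T_k for every evader move n_e at s}. Then for every state s and every natural number k, D*(s) ≤ k if and only if s ∈ T_k. (This is the correctness of the dynamic-programming state-expansion: D* is computed by iterated backward expansion from the terminal states.) -/
open scoped ENat

/-- `np` is a valid joint pursuer move from pursuer positions `sp`:
each pursuer stays or moves to an adjacent vertex (closed neighborhood). -/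
def IsPMove {V : Type*} (G : SimpleGraph V) {m : ℕ} (sp np : Fin m → V) : Prop :=
  ∀ i, np i = sp i ∨ G.Adj (sp i) (np i)

/-- `ne` is a valid evader move from evader position `se`:
the evader stays or moves to an adjacent vertex (closed neighborhood). -/
def IsEMove {V : Type*} (G : SimpleGraph V) (se ne : V) : Prop :=
  ne = se ∨ G.Adj se ne

open Classical in
/-- The Bellman operator on `(states) → ℕ∞`: value `0` at terminal states, and otherwise
`1 +` the minimum over pursuer moves of the maximum over evader moves of `D` at the next state. -/
noncomputable def bellman {V : Type*} (G : SimpleGraph V) {m : ℕ}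
    (f : ((Fin m → V) × V) → Prop) (D : ((Fin m → V) × V) → ℕ∞) :
    ((Fin m → V) × V) → ℕ∞ :=
  fun s => if f s then 0 else
    1 + ⨅ np : {np : Fin m → V // IsPMove G s.1 np},
          ⨆ ne : {ne : V // IsEMove G s.2 ne}, D (np.1, ne.1)

/-- The iterated backward state-expansion sets: `Tset 0` is the set of terminal states, and
`Tset (k+1)` adds the nonterminal states from which some pursuer move reaches `Tset k`
against every evader move. -/
def Tset {V : Type*} (G : SimpleGraph V) {m : ℕ}
    (f : ((Fin m → V) × V) → Prop) : ℕ → Set ((Fin m → V) × V)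
  | 0 => {s | f s}
  | k + 1 => Tset G f k ∪
      {s | ¬ f s ∧ ∃ np : Fin m → V, IsPMove G s.1 np ∧
        ∀ ne : V, IsEMove G s.2 ne → (np, ne) ∈ Tset G f k}

theorem bellman_le_zero_iff {V : Type*} (G : SimpleGraph V) {m : ℕ}
    (f : ((Fin m → V) × V) → Prop) (D : ((Fin m → V) × V) → ℕ∞) (s : (Fin m → V) × V) :
    bellman G f D s ≤ 0 ↔ f s := by
  by_cases hs : f s <;> simp [bellman, hs]

theorem bellman_le_add_one_iff {V : Type*} (G : SimpleGraph V) {m : ℕ}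
    (f : ((Fin m → V) × V) → Prop) (D : ((Fin m → V) × V) → ℕ∞) (s : (Fin m → V) × V) (k : ℕ) :
    bellman G f D s ≤ (k : ℕ∞) + 1 ↔
      f s ∨ ∃ np, IsPMove G s.1 np ∧ ∀ ne, IsEMove G s.2 ne → D (np, ne) ≤ k := by
  by_cases hs : f s
  · simp [bellman, hs]
  · have lt_add_one_iff (x : ℕ∞) : x < (k : ℕ∞) + 1 ↔ x ≤ k :=
      ENat.lt_add_one_iff (ENat.natCast_ne_top k)
    simp only [bellman, hs, if_false, false_or]
    rw [add_comm, ENat.add_le_add_iff_right ENat.one_ne_top, ← lt_add_one_iff, iInf_lt_iff]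
    simp only [lt_add_one_iff, iSup_le_iff, Subtype.forall, Subtype.exists, exists_prop]

/-- The characterization holds for every fixed point of the Bellman operator. -/
theorem le_iff_mem_Tset_of_bellman_eq {V : Type*} (G : SimpleGraph V) {m : ℕ}
    (f : ((Fin m → V) × V) → Prop) {D : ((Fin m → V) × V) → ℕ∞} (hD : bellman G f D = D)
    (s : (Fin m → V) × V) (k : ℕ) : D s ≤ k ↔ s ∈ Tset G f k := by
  induction k generalizing s with
  | zero =>
    rw [← hD, Nat.cast_zero, bellman_le_zero_iff]
    rfl
  | succ k ih =>
    have step := bellman_le_add_one_iff G f D s k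
    rw [hD] at step
    simp only [Tset, Set.mem_union, Set.mem_ofPred_eq, Nat.cast_add, Nat.cast_one, ← ih]
    constructor
    · intro h
      by_cases hs : f s
      · have h_zero := (bellman_le_zero_iff G f D s).2 hs
        rw [hD] at h_zero
        exact Or.inl (h_zero.trans bot_le)
      · exact Or.inr ⟨hs, (step.1 h).resolve_left hs⟩
    · rintro (h | ⟨-, h⟩)
      · exact h.trans le_self_add
      · exact step.2 (Or.inr h)

/-- Correctness of the dynamic-programming state expansion: for every state `s` and
every natural number `k`, `Dstar s ≤ k` iff `s ∈ Tset G f k`. -/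
theorem lfp_le_iff_mem_Tset
    (V : Type*) [Fintype V] [Nonempty V] (G : SimpleGraph V)
    (m : ℕ) (hm : 1 ≤ m) (f : ((Fin m → V) × V) → Prop)
    (Dstar : ((Fin m → V) × V) → ℕ∞)
    (hD : IsLeast {D | bellman G f D = D} Dstar) :
    ∀ (s : (Fin m → V) × V) (k : ℕ),
      Dstar s ≤ (k : ℕ∞) ↔ s ∈ Tset G f k := by
  exact le_iff_mem_Tset_of_bellman_eq G f hD.1
end

section
/- (Pursuer side of the near-optimality of the DP policy.) Let s₀ be a state with D*(s₀) = d for some natural number d (i.e., D*(s₀) < ∞). Then there exists a positional pursuer strategy σ such that every play from s₀ following σ reaches capture within d steps: for every such play (s_t), there exists t ≤ d with f(s_t). -/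
open scoped ENat

theorem exists_isPMove_iSup_eq {V : Type*} (G : SimpleGraph V) {m : ℕ}
    (D : ((Fin m → V) × V) → ℕ∞) (s : (Fin m → V) × V) :
    ∃ np, IsPMove G s.1 np ∧
      ⨆ ne : {ne : V // IsEMove G s.2 ne}, D (np, ne.1) =
        ⨅ np : {np : Fin m → V // IsPMove G s.1 np},
          ⨆ ne : {ne : V // IsEMove G s.2 ne}, D (np.1, ne.1) := by
  have : Nonempty {np : Fin m → V // IsPMove G s.1 np} := ⟨s.1, fun _ => Or.inl rfl⟩
  obtain ⟨np, h⟩ := ciInf_mem fun np : {np : Fin m → V // IsPMove G s.1 np} =>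
    ⨆ ne : {ne : V // IsEMove G s.2 ne}, D (np.1, ne.1)
  exact ⟨np.1, np.2, h⟩

/-- Along a play whose pursuers always attain the Bellman minimum of a fixed point `D`,
capture occurs within `n` further steps of any time at which `D` is at most `n`. -/
theorem exists_capture_of_le {V : Type*} {G : SimpleGraph V} {m : ℕ}
    {f : ((Fin m → V) × V) → Prop} {D : ((Fin m → V) × V) → ℕ∞} (hD : bellman G f D = D)
    {play : ℕ → (Fin m → V) × V}
    (hE : ∀ t, IsEMove G (play t).2 (play (t + 1)).2)
    (hP : ∀ t, ⨆ ne : {ne : V // IsEMove G (play t).2 ne}, D ((play (t + 1)).1, ne.1) =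
      ⨅ np : {np : Fin m → V // IsPMove G (play t).1 np},
        ⨆ ne : {ne : V // IsEMove G (play t).2 ne}, D (np.1, ne.1))
    (n t : ℕ) (hn : D (play t) ≤ n) : ∃ k ≤ n, f (play (t + k)) := by
  induction n generalizing t with
  | zero =>
    refine ⟨0, le_rfl, ?_⟩
    by_contra (hf : ¬ f (play t))
    rw [← hD, bellman, if_neg hf] at hn
    simp at hn
  | succ n ih =>
    by_cases hf : f (play t)
    · exact ⟨0, Nat.zero_le _, hf⟩
    rw [← hD, bellman, if_neg hf, ← hP t, Nat.cast_succ, add_comm,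
      ENat.add_le_add_iff_right ENat.one_ne_top] at hn
    obtain ⟨k, hk, hfk⟩ := ih (t + 1)
      ((le_iSup (fun ne : {ne : V // IsEMove G (play t).2 ne} =>
        D ((play (t + 1)).1, ne.1)) ⟨_, hE t⟩).trans hn)
    exact ⟨k + 1, by lia, by rwa [add_assoc, add_comm 1 k] at hfk⟩

/-- Pursuer side of near-optimality of the DP policy: if `Dstar s₀ = d < ∞`, there is a
positional pursuer strategy `σ` such that every play from `s₀` following `σ` reaches
capture within `d` steps. -/
theorem pursuer_positional_strategy_captures
    (V : Type*) [Fintype V] [Nonempty V] (G : SimpleGraph V)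
    (m : ℕ) (hm : 1 ≤ m) (f : ((Fin m → V) × V) → Prop)
    (Dstar : ((Fin m → V) × V) → ℕ∞)
    (hD : IsLeast {D | bellman G f D = D} Dstar)
    (s₀ : (Fin m → V) × V) (d : ℕ) (hd : Dstar s₀ = (d : ℕ∞)) :
    ∃ σ : ((Fin m → V) × V) → (Fin m → V),
      (∀ s, IsPMove G s.1 (σ s)) ∧
      ∀ play : ℕ → (Fin m → V) × V,
        play 0 = s₀ →
        (∀ t, IsPMove G (play t).1 (play (t + 1)).1) →
        (∀ t, IsEMove G (play t).2 (play (t + 1)).2) →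
        (∀ t, (play (t + 1)).1 = σ (play t)) →
        ∃ t ≤ d, f (play t) := by
  choose σ hσ hmin using exists_isPMove_iSup_eq G Dstar
  refine ⟨σ, hσ, fun play h0 _ hE hfollow => ?_⟩
  simpa using exists_capture_of_le hD.1 hE (fun t => by rw [hfollow t, hmin]) d 0
    (by rw [h0, hd])
end

section
/- (Evader side of the near-optimality of the DP policy.) Assume the interchange condition. Then there exists a positional evader strategy ν such that for every state s₀ and every play (s_t) from s₀ following ν, capture does not occur before time D*(s₀): f(s_t) fails for every natural number t with t < D*(s₀). In particular, if D*(s₀) = ∞ then the evader following ν is never captured. -/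
open scoped ENat

/-- Some evader move attains the outer maximum of the max-min stage value. -/
theorem exists_isEMove_iSup_eq {V : Type*} [Finite V] (G : SimpleGraph V) {m : ℕ}
    (D : ((Fin m → V) × V) → ℕ∞) (s : (Fin m → V) × V) :
    ∃ e, IsEMove G s.2 e ∧
      (⨆ ne : {ne : V // IsEMove G s.2 ne},
        ⨅ np : {np : Fin m → V // IsPMove G s.1 np}, D (np.1, ne.1)) =
      ⨅ np : {np : Fin m → V // IsPMove G s.1 np}, D (np.1, e) := by
  have : Nonempty {ne : V // IsEMove G s.2 ne} := ⟨⟨s.2, Or.inl rfl⟩⟩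
  obtain ⟨e, he⟩ := exists_eq_ciSup_of_finite
    (f := fun ne : {ne : V // IsEMove G s.2 ne} =>
      ⨅ np : {np : Fin m → V // IsPMove G s.1 np}, D (np.1, ne.1))
  exact ⟨e.1, e.2, he.symm⟩

/-- Evader side of near-optimality of the DP policy: under the interchange (minimax
exchange) condition, there is a positional evader strategy `ν` such that, in every play
following `ν` from any `s₀`, capture does not occur before time `Dstar s₀`. -/
theorem evader_positional_strategy_survives
    (V : Type*) [Fintype V] [Nonempty V] (G : SimpleGraph V)
    (m : ℕ) (hm : 1 ≤ m) (f : ((Fin m → V) × V) → Prop)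
    (Dstar : ((Fin m → V) × V) → ℕ∞)
    (hD : IsLeast {D | bellman G f D = D} Dstar)
    (hI : ∀ s : (Fin m → V) × V,
      (⨅ np : {np : Fin m → V // IsPMove G s.1 np},
        ⨆ ne : {ne : V // IsEMove G s.2 ne}, Dstar (np.1, ne.1)) =
      (⨆ ne : {ne : V // IsEMove G s.2 ne},
        ⨅ np : {np : Fin m → V // IsPMove G s.1 np}, Dstar (np.1, ne.1))) :
    ∃ ν : ((Fin m → V) × V) → V,
      (∀ s, IsEMove G s.2 (ν s)) ∧
      ∀ (s₀ : (Fin m → V) × V) (play : ℕ → (Fin m → V) × V),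
        play 0 = s₀ →
        (∀ t, IsPMove G (play t).1 (play (t + 1)).1) →
        (∀ t, IsEMove G (play t).2 (play (t + 1)).2) →
        (∀ t, (play (t + 1)).2 = ν (play t)) →
        ∀ t : ℕ, (t : ℕ∞) < Dstar s₀ → ¬ f (play t) := by
  choose ν hν hmax using exists_isEMove_iSup_eq G Dstar
  have value : ∀ s, Dstar s = bellman G f Dstar s := fun s => (congrFun hD.1 s).symm
  refine ⟨ν, hν, fun s₀ play h0 hp _ hplay t ht hf => ?_⟩
  have step : ∀ t, Dstar (play t) ≤ 1 + Dstar (play (t + 1)) := by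
    intro t
    rw [value (play t), bellman]
    split_ifs
    · exact zero_le
    · rw [hI, hmax]
      gcongr
      refine (iInf_le _ ⟨(play (t + 1)).1, hp t⟩).trans_eq ?_
      rw [← hplay t]
  have bound : ∀ t : ℕ, Dstar s₀ ≤ t + Dstar (play t) := by
    intro t
    induction t with
    | zero => simp [h0]
    | succ t ih =>
      calc Dstar s₀ ≤ t + Dstar (play t) := ih
        _ ≤ t + (1 + Dstar (play (t + 1))) := by gcongr; exact step t
        _ = (t + 1 : ℕ) + Dstar (play (t + 1)) := by push_cast; rw [add_assoc]
  have hzero : Dstar (play t) = 0 := by rw [value, bellman, if_pos hf]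
  exact absurd (bound t) (by simpa [hzero] using ht)
end

section
/- (Theorem 1, combinatorial value form: D* is the exact optimal guaranteed capture time.) Assume the interchange condition. Then for every state s₀ and every natural number d, the following are equivalent: (i) D*(s₀) ≤ d; (ii) there exists a positional pursuer strategy σ such that every play from s₀ following σ satisfies f(s_t) for some t ≤ d. -/
open scoped ENat

/-- Every play from `s` in which the pursuers follow `σ` meets `f` within `d` steps. -/
def CapturesWithin {V : Type*} (G : SimpleGraph V) {m : ℕ} (f : ((Fin m → V) × V) → Prop)
    (σ : ((Fin m → V) × V) → (Fin m → V)) (s : (Fin m → V) × V) (d : ℕ) : Prop :=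
  ∀ play : ℕ → (Fin m → V) × V,
    play 0 = s →
    (∀ t, IsPMove G (play t).1 (play (t + 1)).1) →
    (∀ t, IsEMove G (play t).2 (play (t + 1)).2) →
    (∀ t, (play (t + 1)).1 = σ (play t)) →
    ∃ t ≤ d, f (play t)

section Bellman

variable {V : Type*} {G : SimpleGraph V} {m : ℕ} {f : ((Fin m → V) × V) → Prop}
  {D : ((Fin m → V) × V) → ℕ∞} {σ : ((Fin m → V) × V) → (Fin m → V)}

theorem eq_zero_of_terminal (hD : bellman G f D = D) {s : (Fin m → V) × V} (hs : f s) :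
    D s = 0 := by
  rw [← hD, bellman, if_pos hs]

theorem eq_one_add_of_not_terminal (hD : bellman G f D = D) {s : (Fin m → V) × V}
    (hs : ¬ f s) :
    D s = 1 + ⨅ np : {np : Fin m → V // IsPMove G s.1 np},
      ⨆ ne : {ne : V // IsEMove G s.2 ne}, D (np.1, ne.1) := by
  conv_lhs => rw [← hD, bellman, if_neg hs]

/-- A pursuer strategy attaining the minimum in the Bellman operator at every state. -/
theorem exists_greedy_strategy (G : SimpleGraph V) (D : ((Fin m → V) × V) → ℕ∞) :
    ∃ σ : ((Fin m → V) × V) → (Fin m → V), (∀ s, IsPMove G s.1 (σ s)) ∧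
      ∀ s, (⨆ ne : {ne : V // IsEMove G s.2 ne}, D (σ s, ne.1)) =
        ⨅ np : {np : Fin m → V // IsPMove G s.1 np},
          ⨆ ne : {ne : V // IsEMove G s.2 ne}, D (np.1, ne.1) := by
  have attained (s : (Fin m → V) × V) :
      ∃ np : {np : Fin m → V // IsPMove G s.1 np},
        (⨆ ne : {ne : V // IsEMove G s.2 ne}, D (np.1, ne.1)) =
          ⨅ np : {np : Fin m → V // IsPMove G s.1 np},
            ⨆ ne : {ne : V // IsEMove G s.2 ne}, D (np.1, ne.1) := by
    have : Nonempty {np : Fin m → V // IsPMove G s.1 np} := ⟨⟨s.1, fun _ => Or.inl rfl⟩⟩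
    exact ENat.exists_eq_iInf _
  choose σ hσ using attained
  exact ⟨fun s => (σ s).1, fun s => (σ s).2, hσ⟩

theorem capturesWithin_of_le (hD : bellman G f D = D)
    (hσ : ∀ s, (⨆ ne : {ne : V // IsEMove G s.2 ne}, D (σ s, ne.1)) =
      ⨅ np : {np : Fin m → V // IsPMove G s.1 np},
        ⨆ ne : {ne : V // IsEMove G s.2 ne}, D (np.1, ne.1))
    {s : (Fin m → V) × V} {d : ℕ} (h : D s ≤ d) : CapturesWithin G f σ s d := by
  induction d generalizing s with
  | zero =>
    intro play h0 _ _ _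
    refine ⟨0, le_rfl, ?_⟩
    by_contra hs
    rw [h0] at hs
    rw [eq_one_add_of_not_terminal hD hs] at h
    simp at h
  | succ d ih =>
    intro play h0 hp he hf
    by_cases hs : f s
    · exact ⟨0, Nat.zero_le _, h0 ▸ hs⟩
    rw [eq_one_add_of_not_terminal hD hs, ← hσ, Nat.cast_add, Nat.cast_one, add_comm,
      ENat.add_le_add_iff_right ENat.one_ne_top] at h
    have hnext : D (play 1) ≤ d := by
      have hmove : IsEMove G s.2 (play 1).2 := h0 ▸ he 0
      have heq : play 1 = (σ s, (play 1).2) := Prod.ext (h0 ▸ hf 0) rfl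
      rw [heq]
      exact (iSup_le_iff.1 h) ⟨_, hmove⟩
    obtain ⟨t, ht, hft⟩ := ih hnext (fun t => play (t + 1)) rfl
      (fun t => hp (t + 1)) (fun t => he (t + 1)) (fun t => hf (t + 1))
    exact ⟨t + 1, Nat.succ_le_succ ht, hft⟩

/-- A guarantee within `d + 1` steps from a nonterminal state passes to its successors. -/
theorem CapturesWithin.next (hσ : ∀ s, IsPMove G s.1 (σ s)) {s : (Fin m → V) × V} {d : ℕ}
    (h : CapturesWithin G f σ s (d + 1)) (hs : ¬ f s) {e : V} (he : IsEMove G s.2 e) :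
    CapturesWithin G f σ (σ s, e) d := by
  intro play h0 hp hev hf
  let extended : ℕ → (Fin m → V) × V := fun t => Nat.casesOn t s play
  obtain ⟨t, ht, hft⟩ := h extended rfl
    (by rintro (_ | t)
        · change IsPMove G s.1 (play 0).1
          rw [h0]
          exact hσ s
        · exact hp t)
    (by rintro (_ | t)
        · change IsEMove G s.2 (play 0).2
          rw [h0]
          exact he
        · exact hev t)
    (by rintro (_ | t)
        · change (play 0).1 = σ s
          rw [h0]
        · exact hf t)
  cases t with
  | zero => exact absurd hft hs
  | succ t => exact ⟨t, Nat.le_of_succ_le_succ ht, hft⟩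

theorem CapturesWithin.terminal_of_zero (hσ : ∀ s, IsPMove G s.1 (σ s))
    {s : (Fin m → V) × V} (h : CapturesWithin G f σ s 0) : f s := by
  let step : (Fin m → V) × V → (Fin m → V) × V := fun s => (σ s, s.2)
  have hstep (t : ℕ) : step^[t + 1] s = step (step^[t] s) := Function.iterate_succ_apply' ..
  obtain ⟨t, ht, hft⟩ := h (fun t => step^[t] s) rfl
    (fun t => by simp only [hstep]; exact hσ _)
    (fun t => by simp only [hstep]; exact Or.inl rfl)
    (fun t => by simp only [hstep]; rfl)
  obtain rfl := Nat.le_zero.1 ht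
  exact hft

theorem CapturesWithin.le (hD : bellman G f D = D) (hσ : ∀ s, IsPMove G s.1 (σ s))
    {s : (Fin m → V) × V} {d : ℕ} (h : CapturesWithin G f σ s d) : D s ≤ d := by
  induction d generalizing s with
  | zero => simp [eq_zero_of_terminal hD (h.terminal_of_zero hσ)]
  | succ d ih =>
    by_cases hs : f s
    · simp [eq_zero_of_terminal hD hs]
    rw [eq_one_add_of_not_terminal hD hs, Nat.cast_add, Nat.cast_one, add_comm]
    gcongr
    exact iInf_le_of_le ⟨σ s, hσ s⟩ (iSup_le fun e => ih (h.next hσ hs e.2))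

/-- Any fixed point of the Bellman operator is the optimal guaranteed capture time. -/
theorem le_iff_exists_capturesWithin (hD : bellman G f D = D) (s : (Fin m → V) × V) (d : ℕ) :
    D s ≤ d ↔ ∃ σ : ((Fin m → V) × V) → (Fin m → V),
      (∀ s, IsPMove G s.1 (σ s)) ∧ CapturesWithin G f σ s d := by
  constructor
  · intro h
    obtain ⟨σ, hmove, hσ⟩ := exists_greedy_strategy G D
    exact ⟨σ, hmove, capturesWithin_of_le hD hσ h⟩
  · rintro ⟨σ, hmove, h⟩
    exact h.le hD hmove

end Bellman

/-- Theorem 1, combinatorial value form: under the interchange condition, `Dstar s₀ ≤ d`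
iff some positional pursuer strategy guarantees capture within `d` steps from `s₀`. -/
theorem lfp_eq_optimal_capture_time
    (V : Type*) [Fintype V] [Nonempty V] (G : SimpleGraph V)
    (m : ℕ) (hm : 1 ≤ m) (f : ((Fin m → V) × V) → Prop)
    (Dstar : ((Fin m → V) × V) → ℕ∞)
    (hD : IsLeast {D | bellman G f D = D} Dstar)
    (hI : ∀ s : (Fin m → V) × V,
      (⨅ np : {np : Fin m → V // IsPMove G s.1 np},
        ⨆ ne : {ne : V // IsEMove G s.2 ne}, Dstar (np.1, ne.1)) =
      (⨆ ne : {ne : V // IsEMove G s.2 ne},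
        ⨅ np : {np : Fin m → V // IsPMove G s.1 np}, Dstar (np.1, ne.1)))
    (s₀ : (Fin m → V) × V) (d : ℕ) :
    Dstar s₀ ≤ (d : ℕ∞) ↔
      ∃ σ : ((Fin m → V) × V) → (Fin m → V),
        (∀ s, IsPMove G s.1 (σ s)) ∧
        ∀ play : ℕ → (Fin m → V) × V,
          play 0 = s₀ →
          (∀ t, IsPMove G (play t).1 (play (t + 1)).1) →
          (∀ t, IsEMove G (play t).2 (play (t + 1)).2) →
          (∀ t, (play (t + 1)).1 = σ (play t)) →
          ∃ t ≤ d, f (play t) := by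
  exact le_iff_exists_capturesWithin hD.1 s₀ d
end

section
/- (Theorem 1, value formula: V*(s) = γ^{D(s)} solves the simplified Bellman minimax equation.) Define V : states → ℝ by V(s) = γ^{D*(s)}, with the convention γ^∞ = 0. Then V(s) = 1 whenever f(s) holds, and for every state s with ¬f(s), V(s) = γ · (maximum over pursuer moves n_p at s of the minimum over evader moves n_e at s of V(n_p, n_e)). -/
open scoped ENat

open Classical in
/-- `γ ^ n` for `n : ℕ∞`, with the convention `γ ^ ∞ = 0`. -/
noncomputable def gammaPow (γ : ℝ) (n : ℕ∞) : ℝ :=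
  if n = ⊤ then 0 else γ ^ n.toNat

theorem Antitone.map_iInf_of_finite {α β ι : Type*} [ConditionallyCompleteLinearOrder α]
    [ConditionallyCompleteLinearOrder β] [Finite ι] [Nonempty ι] {g : α → β} (hg : Antitone g)
    (u : ι → α) : g (⨅ i, u i) = ⨆ i, g (u i) := by
  apply le_antisymm
  · obtain ⟨i, hi⟩ := exists_eq_ciInf_of_finite (f := u)
    rw [← hi]
    exact le_ciSup (f := fun i => g (u i)) (Set.finite_range _).bddAbove i
  · exact ciSup_le fun i => hg (ciInf_le (Set.finite_range _).bddBelow i)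

theorem Antitone.map_iSup_of_finite {α β ι : Type*} [ConditionallyCompleteLinearOrder α]
    [ConditionallyCompleteLinearOrder β] [Finite ι] [Nonempty ι] {g : α → β} (hg : Antitone g)
    (u : ι → α) : g (⨆ i, u i) = ⨅ i, g (u i) :=
  hg.dual.map_iInf_of_finite (α := αᵒᵈ) (β := βᵒᵈ) u

theorem gammaPow_zero (γ : ℝ) : gammaPow γ 0 = 1 := by
  simp [gammaPow]

theorem gammaPow_one_add (γ : ℝ) (n : ℕ∞) : gammaPow γ (1 + n) = γ * gammaPow γ n := by
  induction n using ENat.recTopCoe with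
  | top => simp [gammaPow]
  | coe n =>
    have h : (1 + n : ℕ∞) = ((n + 1 : ℕ) : ℕ∞) := by push_cast; exact add_comm _ _
    rw [h]
    simp only [gammaPow, ENat.natCast_ne_top, if_false, ENat.toNat_natCast]
    exact pow_succ' γ n

theorem gammaPow_antitone {γ : ℝ} (h0 : 0 ≤ γ) (h1 : γ ≤ 1) : Antitone (gammaPow γ) := by
  intro a b hab
  by_cases hb : b = ⊤
  · rw [gammaPow, if_pos hb, gammaPow]
    split_ifs
    · exact le_rfl
    · exact pow_nonneg h0 _
  · rw [gammaPow, if_neg hb, gammaPow, if_neg (ne_top_of_le_ne_top hb hab)]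
    exact pow_le_pow_of_le_one h0 h1 (ENat.toNat_le_toNat hab hb)

/-- Theorem 1, value formula: `V(s) = γ ^ Dstar s` (with `γ ^ ∞ = 0`) satisfies the
simplified Bellman minimax equation: `V s = 1` at terminal states, and at nonterminal
states `V s = γ *` (max over pursuer moves of the min over evader moves of `V` next). -/
theorem gammaPow_lfp_solves_bellman_minimax
    (V : Type*) [Fintype V] [Nonempty V] (G : SimpleGraph V)
    (m : ℕ) (hm : 1 ≤ m) (f : ((Fin m → V) × V) → Prop)
    (Dstar : ((Fin m → V) × V) → ℕ∞)
    (hD : IsLeast {D | bellman G f D = D} Dstar)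
    (γ : ℝ) (hγ0 : 0 < γ) (hγ1 : γ < 1) :
    (∀ s : (Fin m → V) × V, f s → gammaPow γ (Dstar s) = 1) ∧
    (∀ s : (Fin m → V) × V, ¬ f s →
      gammaPow γ (Dstar s) =
        γ * ⨆ np : {np : Fin m → V // IsPMove G s.1 np},
              ⨅ ne : {ne : V // IsEMove G s.2 ne},
                gammaPow γ (Dstar (np.1, ne.1))) := by
  have hfix : bellman G f Dstar = Dstar := hD.1
  have hanti : Antitone (gammaPow γ) := gammaPow_antitone hγ0.le hγ1.le
  refine ⟨fun s hs => ?_, fun s hs => ?_⟩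
  · rw [← congrFun hfix s, bellman, if_pos hs, gammaPow_zero]
  · have : Nonempty {np : Fin m → V // IsPMove G s.1 np} := ⟨⟨s.1, fun _ => Or.inl rfl⟩⟩
    have : Nonempty {ne : V // IsEMove G s.2 ne} := ⟨⟨s.2, Or.inl rfl⟩⟩
    conv_lhs => rw [← congrFun hfix s, bellman, if_neg hs]
    rw [gammaPow_one_add, hanti.map_iInf_of_finite]
    simp only [hanti.map_iSup_of_finite]
end

section
/- (Guaranteed pursuit on trees with adjacency capture.) Suppose in addition that G is a tree (connected and acyclic) with at least one vertex, that m = 1 (a single pursuer), and that the terminal predicate is f(s_p, s_e) ⟺ (s_p 0 = s_e or s_p 0 is adjacent to s_e) (capture by adjacency). Then D*(s) < ∞ for every state s; that is, successful pursuit is guaranteed from every initial state. -/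
open scoped ENat

/-- The vertices that `e` can reach in `G` without visiting `p`. -/
def avoidingRegion {V : Type*} (G : SimpleGraph V) (p e : V) : Set V :=
  {v | ∃ w : G.Walk e v, p ∉ w.support}

/-- In a tree, the first step from `p` towards `e ≠ p` separates `e` from `p`. -/
theorem SimpleGraph.IsTree.exists_adj_separating {V : Type*} {G : SimpleGraph V}
    (hG : G.IsTree) {p e : V} (hpe : p ≠ e) :
    ∃ q, G.Adj p q ∧ q ∈ avoidingRegion G p e ∧ ∀ w : G.Walk e p, q ∈ w.support := by
  classical
  obtain ⟨r, hr, huniq⟩ := hG.existsUnique_path p e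
  cases r with
  | nil => exact absurd rfl hpe
  | @cons _ q _ h r' =>
    rw [SimpleGraph.Walk.cons_isPath_iff] at hr
    refine ⟨q, h, ⟨r'.reverse, by simpa using hr.2⟩, fun w => ?_⟩
    have hw := huniq w.reverse.bypass w.reverse.bypass_isPath
    have hq : q ∈ w.reverse.bypass.support := by
      rw [hw]
      simp
    simpa using w.reverse.support_bypass_subset_support hq

/-- If `q` lies in the region of `e` avoiding `p` and separates `e` from `p`, then moving the
pursuer from `p` to `q` strictly shrinks the region, whatever the evader replies. -/
theorem avoidingRegion_ssubset {V : Type*} {G : SimpleGraph V} {p q e e' : V}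
    (hq : q ∈ avoidingRegion G p e) (hsep : ∀ w : G.Walk e p, q ∈ w.support)
    (hpe : p ≠ e) (hqe : q ≠ e) (he : IsEMove G e e') :
    avoidingRegion G q e' ⊂ avoidingRegion G p e := by
  classical
  have hlift {x v : V} (hx : x ≠ e) (w : G.Walk e' v) (hw : x ∉ w.support) :
      ∃ u : G.Walk e v, x ∉ u.support := by
    rcases he with rfl | h
    · exact ⟨w, hw⟩
    · exact ⟨.cons h w, by simp [hx, hw]⟩
  refine (Set.ssubset_iff_of_subset ?_).mpr
    ⟨q, hq, fun ⟨w, hw⟩ => hw w.end_mem_support⟩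
  rintro v ⟨w, hw⟩
  refine hlift hpe w fun hp => ?_
  obtain ⟨u, hu⟩ := hlift hqe (w.takeUntil p hp)
    fun h => hw (w.support_takeUntil_subset_support hp h)
  exact hu (hsep u)

/-- A fixed point of the Bellman operator is finite at every state from which some pursuer move
leads only to states where it is finite. -/
theorem lt_top_of_bellman_eq {V : Type*} [Finite V] {G : SimpleGraph V} {m : ℕ}
    {f : ((Fin m → V) × V) → Prop} {D : ((Fin m → V) × V) → ℕ∞} (hD : bellman G f D = D)
    {s : (Fin m → V) × V} {np : Fin m → V} (hnp : IsPMove G s.1 np)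
    (h : ∀ ne, IsEMove G s.2 ne → D (np, ne) < ⊤) : D s < ⊤ := by
  rw [← hD, bellman]
  split_ifs
  · exact ENat.top_pos
  · refine WithTop.add_lt_top.mpr ⟨ENat.one_lt_top, ?_⟩
    refine (iInf_le _ ⟨np, hnp⟩).trans_lt ?_
    have : Nonempty {ne : V // IsEMove G s.2 ne} := ⟨⟨s.2, Or.inl rfl⟩⟩
    obtain ⟨i, hi⟩ := exists_eq_ciSup_of_finite
      (f := fun ne : {ne : V // IsEMove G s.2 ne} => D (np, ne.1))
    rw [← hi]
    exact h i.1 i.2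

/-- Guaranteed pursuit on trees with adjacency capture: if `G` is a tree, there is a single
pursuer (`m = 1`), and the terminal predicate is capture by adjacency
(`f (sp, se) ↔ sp 0 = se ∨ G.Adj (sp 0) se`), then `Dstar s < ∞` for every state `s`. -/
theorem tree_pursuit_guaranteed
    (V : Type*) [Fintype V] [Nonempty V] (G : SimpleGraph V)
    (htree : G.IsTree)
    (f : ((Fin 1 → V) × V) → Prop)
    (hf : ∀ s : (Fin 1 → V) × V, f s ↔ (s.1 0 = s.2 ∨ G.Adj (s.1 0) s.2))
    (Dstar : ((Fin 1 → V) × V) → ℕ∞)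
    (hD : IsLeast {D | bellman G f D = D} Dstar) :
    ∀ s : (Fin 1 → V) × V, Dstar s < ⊤ := by
  intro s
  obtain ⟨n, hn⟩ : ∃ n, (avoidingRegion G (s.1 0) s.2).ncard = n := ⟨_, rfl⟩
  induction n using Nat.strong_induction_on generalizing s with
  | _ n ih =>
    have hfix : bellman G f Dstar = Dstar := hD.1
    by_cases hs : f s
    · rw [← hfix, bellman, if_pos hs]
      exact ENat.top_pos
    · obtain ⟨hne, hadj⟩ := not_or.mp (mt (hf s).mpr hs)
      obtain ⟨q, hpq, hq, hsep⟩ := htree.exists_adj_separating hne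
      have hqe : q ≠ s.2 := fun h => hadj (h ▸ hpq)
      refine lt_top_of_bellman_eq hfix (np := fun _ => q)
        (fun i => Or.inr (by rwa [Subsingleton.elim i 0])) fun ne hmove => ?_
      exact ih _ (hn ▸ Set.ncard_lt_ncard (avoidingRegion_ssubset hq hsep hne hqe hmove)) _ rfl
end

section
/- (Sufficiency half of the exit-blocking criterion.) Let e, x, p be vertices with dist(p, x) ≤ dist(e, x). Then there exists a pursuer trajectory (p_t)_{t∈ℕ} with p_0 = p and p_{t+1} ∈ N[p_t] for all t, such that for every evader trajectory (e_t)_{t∈ℕ} with e_0 = e and e_{t+1} ∈ N[e_t] for all t, and for every time t: if e_t = x then p_t = x. That is, a single pursuer that is at least as close to an exit as the evader (with respect to shortest-path distance) can block that exit. -/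
/-- A sequence of vertices moving within closed neighborhoods travels distance at most `t`
in `t` steps. -/
lemma SimpleGraph.Connected.dist_le_of_forall_eq_or_adj {V : Type*} {G : SimpleGraph V}
    (hG : G.Connected) {f : ℕ → V} (hf : ∀ t, f (t + 1) = f t ∨ G.Adj (f t) (f (t + 1)))
    (t : ℕ) : G.dist (f 0) (f t) ≤ t := by
  induction t with
  | zero => simp
  | succ t ih =>
    rcases hf t with heq | hadj
    · rw [heq]
      exact ih.trans t.le_succ
    · have hone : G.dist (f t) (f (t + 1)) = 1 := G.dist_eq_one_iff_adj.mpr hadj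
      have htri := hG.dist_triangle (u := f 0) (v := f t) (w := f (t + 1))
      omega

/-- Sufficiency half of the exit-blocking criterion: if `dist p x ≤ dist e x`, then there is
a pursuer trajectory starting at `p` (moving within closed neighborhoods at each step) such
that, for every evader trajectory starting at `e` (also moving within closed neighborhoods),
whenever the evader is at the exit `x`, the pursuer is at `x` as well. -/
theorem exit_blocking_sufficiency
    (V : Type*) [Fintype V] (G : SimpleGraph V) (hG : G.Connected)
    (e x p : V) (h : G.dist p x ≤ G.dist e x) :
    ∃ ppath : ℕ → V, ppath 0 = p ∧
      (∀ t, ppath (t + 1) = ppath t ∨ G.Adj (ppath t) (ppath (t + 1))) ∧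
      ∀ epath : ℕ → V, epath 0 = e →
        (∀ t, epath (t + 1) = epath t ∨ G.Adj (epath t) (epath (t + 1))) →
        ∀ t, epath t = x → ppath t = x := by
  obtain ⟨w, hw⟩ := hG.exists_walk_length_eq_dist p x
  refine ⟨w.getVert, w.getVert_zero, fun t ↦ ?_, fun epath h0 hstep t ht ↦ ?_⟩
  · rcases lt_or_ge t w.length with hlt | hge
    · exact Or.inr (w.adj_getVert_succ hlt)
    · left
      rw [w.getVert_of_length_le hge, w.getVert_of_length_le (hge.trans t.le_succ)]
  · have hdist := hG.dist_le_of_forall_eq_or_adj hstep t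
    rw [h0, ht] at hdist
    exact w.getVert_of_length_le (hw.le.trans (h.trans hdist))
end
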